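/- Let ℓ ≥ 3. On ℝ^{3ℓ−3} with coordinates (x, y⁰, y¹, …, y^{ℓ−2}, z¹, …, z^{ℓ−2}, p⁰, p¹, …, p^{ℓ−2}), let 𝒟 be the rank-ℓ distribution spanned at every point by the vector fields ∂_{p⁰}, ∂_{p¹}, …, ∂_{p^{ℓ−2}} and D_x = ∂_x + p⁰ ∂_{y⁰} + Σᵢ pⁱ ∂_{yⁱ} + Σᵢ p⁰ pⁱ ∂_{zⁱ} (the canonical distribution of the Monge system żⁱ = ẏ⁰ ẏⁱ, 1 ≤ i ≤ ℓ−2). Then the Lie algebra sym(𝒟) of all smooth vector fields X on ℝ^{3ℓ−3} such that [X, V] is a section of 𝒟 for every section V of 𝒟 is finite dimensional and isomorphic, as a real Lie algebra, to sl(ℓ+1, ℝ). -/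

import Mathlib

open scoped BigOperators

/-- Coordinates `(x, y⁰, y¹, …, y^k, z¹, …, z^k, p⁰, p¹, …, p^k)` (with `k = ℓ - 2`)
on `ℝ^{3ℓ-3}`. -/
inductive ACo (k : ℕ) : Type
  | x : ACo k
  | y0 : ACo k
  | y : Fin k → ACo k
  | z : Fin k → ACo k
  | p0 : ACo k
  | p : Fin k → ACo k
  deriving DecidableEq, Fintype

/-- Points of `ℝ^{3ℓ-3}`. -/
abbrev APt (k : ℕ) := ACo k → ℝ

/-- The constant coordinate vector field `∂ᵢ`. -/
def aunit (k : ℕ) (i : ACo k) : APt k := fun j => if j = i then 1 else 0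

/-- The total derivative vector field
`D_x = ∂_x + p⁰ ∂_{y⁰} + Σᵢ pⁱ ∂_{yⁱ} + Σᵢ p⁰ pⁱ ∂_{zⁱ}` of the Monge system
`żⁱ = ẏ⁰ ẏⁱ`. -/
noncomputable def aDx (k : ℕ) : APt k → APt k := fun q =>
  aunit k ACo.x + q ACo.p0 • aunit k ACo.y0 +
    (∑ i : Fin k, q (ACo.p i) • aunit k (ACo.y i)) +
    ∑ i : Fin k, (q ACo.p0 * q (ACo.p i)) • aunit k (ACo.z i)

/-- The canonical rank-`ℓ` distribution of the Monge system `żⁱ = ẏ⁰ ẏⁱ`,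
spanned by `∂_{p⁰}, ∂_{p¹}, …, ∂_{p^{ℓ-2}}` and `D_x`. -/
noncomputable def aDist (k : ℕ) (q : APt k) : Submodule ℝ (APt k) :=
  Submodule.span ℝ
    (insert (aDx k q)
      (insert (aunit k ACo.p0) (Set.range fun i : Fin k => aunit k (ACo.p i))))

/-- The Lie bracket of vector fields. -/
noncomputable def aBr (k : ℕ) (X W : APt k → APt k) : APt k → APt k := fun q =>
  fderiv ℝ W q (X q) - fderiv ℝ X q (W q)

/-- The Lie algebra of infinitesimal symmetries of the distribution `aDist`. -/
noncomputable def aSym (k : ℕ) : Set (APt k → APt k) :=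
  {X | ContDiff ℝ (⊤ : ℕ∞) X ∧ ∀ W : APt k → APt k, ContDiff ℝ (⊤ : ℕ∞) W →
    (∀ q, W q ∈ aDist k q) → ∀ q, aBr k X W q ∈ aDist k q}

namespace Monge
open VectorField

/-- Position coordinates as a `2 × (k+1)` matrix. -/
def co {k : ℕ} : Bool → Option (Fin k) → ACo k
  | false, none => ACo.x
  | true, none => ACo.y0
  | false, some i => ACo.y i
  | true, some i => ACo.z i

/-- Velocity coordinates. -/
def pv {k : ℕ} : Option (Fin k) → ACo k
  | none => ACo.p0
  | some i => ACo.p i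

def vv {k : ℕ} (q : APt k) : Bool → ℝ
  | false => 1
  | true => q ACo.p0

def ww {k : ℕ} (q : APt k) : Option (Fin k) → ℝ
  | none => 1
  | some i => q (ACo.p i)

def vv' {k : ℕ} (q : APt k) : Bool → ℝ
  | false => 0
  | true => q ACo.p0

def ww' {k : ℕ} (q : APt k) : Option (Fin k) → ℝ
  | none => 0
  | some i => q (ACo.p i)

lemma aco_cases {k : ℕ} (P : ACo k → Prop) (h1 : ∀ a α, P (co a α)) (h2 : ∀ σ, P (pv σ)) :
    ∀ i, P i := by
  intro i
  cases i with
  | x => exact h1 false none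
  | y0 => exact h1 true none
  | y i => exact h1 false (some i)
  | z i => exact h1 true (some i)
  | p0 => exact h2 none
  | p i => exact h2 (some i)

lemma aunit_eq {k : ℕ} (i : ACo k) : aunit k i = Pi.single i 1 := by
  funext j
  simp [aunit, Pi.single_apply]

lemma aunit_co {k : ℕ} (a b : Bool) (α β : Option (Fin k)) :
    aunit k (co b β) (co a α) = if a = b ∧ α = β then 1 else 0 := by
  cases a <;> cases b <;> cases α <;> cases β <;> simp [aunit, co]

lemma aunit_pv_co {k : ℕ} (a : Bool) (α σ : Option (Fin k)) :
    aunit k (pv σ) (co a α) = 0 := by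
  cases a <;> cases α <;> cases σ <;> simp [aunit, co, pv]

lemma aDx_co {k : ℕ} (q : APt k) (a : Bool) (α : Option (Fin k)) :
    aDx k q (co a α) = vv q a * ww q α := by
  cases a <;> cases α <;> simp [aDx, co, vv, ww, aunit, Finset.sum_apply]

lemma aDx_pv {k : ℕ} (q : APt k) (σ : Option (Fin k)) :
    aDx k q (pv σ) = 0 := by
  cases σ <;> simp [aDx, pv, aunit, Finset.sum_apply]

lemma sum_single {k : ℕ} (v : APt k) : v = ∑ i, v i • aunit k i := by
  funext j
  simp [aunit, Finset.sum_apply]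

lemma aunit_pv_mem {k : ℕ} (q : APt k) (σ : Option (Fin k)) : aunit k (pv σ) ∈ aDist k q := by
  apply Submodule.subset_span
  cases σ <;> simp [pv]

lemma decomp_of {k : ℕ} (q v : APt k) (h : ∀ a α, v (co a α) = vv q a * ww q α * v ACo.x) :
    v = v ACo.x • aDx k q + ∑ σ : Option (Fin k), v (pv σ) • aunit k (pv σ) := by
  funext i
  revert i
  apply aco_cases
  · intro a α
    simp [Finset.sum_apply, aDx_co, aunit_pv_co, -Fintype.sum_option]
    rw [h]; ring
  · intro σ
    simp only [Pi.add_apply, Pi.smul_apply, aDx_pv, Finset.sum_apply, smul_eq_mul]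
    rw [Finset.sum_eq_single σ]
    · simp [aunit]
    · intro b _ hb
      have : pv σ ≠ pv b := by
        cases b <;> cases σ <;> simp_all [pv]
        exact fun h => hb h.symm
      simp [aunit, this]
    · simp

lemma mem_aDist {k : ℕ} (q v : APt k) :
    v ∈ aDist k q ↔ ∀ a α, v (co a α) = vv q a * ww q α * v ACo.x := by
  constructor
  · intro h a α
    refine Submodule.span_induction (p := fun v _ => v (co a α) = vv q a * ww q α * v ACo.x)
      ?_ ?_ ?_ ?_ h
    · intro w hw
      simp only [Set.mem_insert_iff, Set.mem_range] at hw
      rcases hw with rfl | rfl | ⟨i, rfl⟩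
      · have := aDx_co q false none
        simp only [co, vv, ww] at this
        rw [aDx_co, this]; ring
      · have h1 := aunit_pv_co a α none
        have h2 := aunit_pv_co (k := k) false none none
        simp only [pv] at h1 h2; simp only [co] at h2
        rw [h1, h2]; ring
      · have h1 := aunit_pv_co a α (some i)
        have h2 := aunit_pv_co (k := k) false none (some i)
        simp only [pv] at h1 h2; simp only [co] at h2
        rw [h1, h2]; ring
    · simp
    · intro x y _ _ hx hy
      simp only [Pi.add_apply, hx, hy]; ring
    · intro c x _ hx
      simp only [Pi.smul_apply, hx, smul_eq_mul]; ring
  · intro h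
    rw [decomp_of q v h]
    refine Submodule.add_mem _ (Submodule.smul_mem _ _ (Submodule.subset_span (by simp))) ?_
    exact Submodule.sum_mem _ fun σ _ => Submodule.smul_mem _ _ (aunit_pv_mem q σ)

/-! ### Smoothness -/

abbrev Sm {k : ℕ} (f : APt k → ℝ) : Prop := ContDiff ℝ (⊤ : ℕ∞) f

/-- Partial derivative. -/
noncomputable def pd {k : ℕ} (i : ACo k) (f : APt k → ℝ) : APt k → ℝ :=
  fun q => fderiv ℝ f q (aunit k i)

lemma Sm.diff {k : ℕ} {f : APt k → ℝ} (h : Sm f) : Differentiable ℝ f :=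
  ContDiff.differentiable h (by simp)

lemma Sm.pd {k : ℕ} {f : APt k → ℝ} (h : Sm f) (i : ACo k) : Sm (pd i f) := by
  have : ContDiff ℝ (⊤ : ℕ∞) (fderiv ℝ f) := ContDiff.fderiv_right h (by simp)
  exact this.clm_apply contDiff_const

lemma fderiv_expand {k : ℕ} (f : APt k → ℝ) (q v : APt k) :
    fderiv ℝ f q v = ∑ i, v i * pd i f q := by
  conv_lhs => rw [sum_single v]
  simp [pd]

lemma two_le_top : (2 : WithTop ℕ∞) ≤ ((⊤ : ℕ∞) : WithTop ℕ∞) := by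
  have : ((2 : ℕ∞) : WithTop ℕ∞) ≤ ((⊤ : ℕ∞) : WithTop ℕ∞) := WithTop.coe_le_coe.2 le_top
  exact this

lemma pd_comm {k : ℕ} {f : APt k → ℝ} (h : Sm f) (i j : ACo k) :
    pd i (pd j f) = pd j (pd i f) := by
  funext q
  have h1 : DifferentiableAt ℝ (fderiv ℝ f) q :=
    (ContDiff.differentiable (n := (⊤ : ℕ∞)) (ContDiff.fderiv_right h (by simp)) (by simp)) q
  have key : ∀ i j, pd i (pd j f) q = fderiv ℝ (fderiv ℝ f) q (aunit k i) (aunit k j) := by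
    intro i j
    unfold pd
    rw [fderiv_clm_apply h1 (by fun_prop)]
    simp
  rw [key, key]
  have hs : IsSymmSndFDerivAt ℝ f q :=
    (ContDiff.contDiffAt h).isSymmSndFDerivAt (by simp only [minSmoothness_of_isRCLikeNormedField]; exact two_le_top)
  exact hs _ _

lemma pd_add {k : ℕ} {f g : APt k → ℝ} (hf : Sm f) (hg : Sm g) (i : ACo k) :
    pd i (f + g) = pd i f + pd i g := by
  funext q
  simp [pd, fderiv_add (hf.diff q) (hg.diff q)]

lemma pd_sub {k : ℕ} {f g : APt k → ℝ} (hf : Sm f) (hg : Sm g) (i : ACo k) :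
    pd i (f - g) = pd i f - pd i g := by
  funext q
  simp [pd, fderiv_sub (hf.diff q) (hg.diff q)]

lemma pd_zero {k : ℕ} (i : ACo k) : pd i (0 : APt k → ℝ) = 0 := by
  funext q
  simp [pd]

lemma eq_of_pd {k : ℕ} {f g : APt k → ℝ} (hf : Sm f) (hg : Sm g)
    (h : ∀ i q, pd i f q = pd i g q) (h0 : f 0 = g 0) : f = g := by
  have h1 : ∀ q, fderiv ℝ (f - g) q = 0 := by
    intro q
    ext v
    rw [fderiv_expand]
    refine Finset.sum_eq_zero fun i _ => ?_
    rw [pd_sub hf hg]; simp [h]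
  funext q
  have := is_const_of_fderiv_eq_zero (𝕜 := ℝ) (hf.diff.sub hg.diff) h1 q 0
  simp [h0] at this
  linarith


/-! ### Characterisation of symmetries -/

/-- Components of a vector field. -/
def cmp {k : ℕ} (X : APt k → APt k) (i : ACo k) : APt k → ℝ := fun q => X q i

lemma cmp_sm {k : ℕ} {X : APt k → APt k} (h : ContDiff ℝ (⊤ : ℕ∞) X) (i : ACo k) :
    Sm (cmp X i) := contDiff_pi.1 h i

lemma fderiv_cmp {k : ℕ} {X : APt k → APt k} (h : ContDiff ℝ (⊤ : ℕ∞) X) (i : ACo k)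
    (q v : APt k) : fderiv ℝ X q v i = fderiv ℝ (cmp X i) q v := by
  have := (hasFDerivAt_pi'.1 (((ContDiff.differentiable h (by simp)) q).hasFDerivAt)) i
  have h2 := this.fderiv
  unfold cmp
  rw [h2]; rfl

lemma vvww_deriv {k : ℕ} (q h : APt k) (a : Bool) (α : Option (Fin k)) :
    DifferentiableAt ℝ (fun q : APt k => vv q a * ww q α) q ∧
    fderiv ℝ (fun q : APt k => vv q a * ww q α) q h = vv' h a * ww q α + vv q a * ww' h α := by
  have h1 : HasFDerivAt (fun q : APt k => vv q a)
      (if a then ContinuousLinearMap.proj (R := ℝ) (φ := fun _ : ACo k => ℝ) ACo.p0 else 0) q := by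
    cases a
    · simpa [vv] using hasFDerivAt_const (1 : ℝ) q
    · simpa [vv] using hasFDerivAt_apply (𝕜 := ℝ) (ACo.p0 : ACo k) q
  have h2 : ∃ L : APt k →L[ℝ] ℝ, HasFDerivAt (fun q : APt k => ww q α) L q ∧ L h = ww' h α := by
    cases α with
    | none => exact ⟨0, by simpa [ww] using hasFDerivAt_const (1 : ℝ) q, by simp [ww']⟩
    | some i => exact ⟨_, hasFDerivAt_apply (𝕜 := ℝ) (ACo.p i : ACo k) q, by simp [ww']⟩
  obtain ⟨L, hL, hL2⟩ := h2
  refine ⟨(h1.mul hL).differentiableAt, ?_⟩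
  rw [show (fun q : APt k => vv q a * ww q α) = (fun q : APt k => vv q a) * fun q => ww q α from rfl,
    (h1.mul hL).fderiv]
  cases a <;> simp [hL2, vv', vv] ; ring

lemma ww_sm {k : ℕ} (α : Option (Fin k)) : Sm (fun q : APt k => ww q α) := by
  cases α
  · exact contDiff_const
  · exact contDiff_apply _ _ _

lemma vv_sm {k : ℕ} (a : Bool) : Sm (fun q : APt k => vv q a) := by
  cases a
  · exact contDiff_const
  · exact contDiff_apply _ _ _

lemma aDx_sm {k : ℕ} : ContDiff ℝ (⊤ : ℕ∞) (aDx k) := by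
  rw [contDiff_pi]
  apply aco_cases
  · intro a α
    simp only [aDx_co]
    exact (vv_sm a).mul (ww_sm α)
  · intro σ
    simp only [aDx_pv]
    exact contDiff_const

/-- Total derivative of the position components. -/
noncomputable def YY {k : ℕ} (X : APt k → APt k) (a : Bool) (α : Option (Fin k)) (q : APt k) : ℝ :=
  fderiv ℝ (cmp X (co a α)) q (aDx k q)

lemma p_const_of_sym {k : ℕ} (hk : 1 ≤ k) {X : APt k → APt k} (hX : X ∈ aSym k) (a : Bool)
    (α σ : Option (Fin k)) : pd (pv σ) (cmp X (co a α)) = 0 := by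
  obtain ⟨hs, hX⟩ := hX
  have h1 : ∀ σ a α q, pd (pv σ) (cmp X (co a α)) q =
      vv q a * ww q α * pd (pv σ) (cmp X ACo.x) q := by
    intro σ a α q
    have := hX (fun _ => aunit k (pv σ)) contDiff_const (fun q => aunit_pv_mem q σ) q
    rw [mem_aDist] at this
    have := this a α
    simp only [aBr, fderiv_const_apply, Pi.sub_apply, fderiv_cmp hs] at this
    simp at this
    unfold pd
    linarith
  have hxs := cmp_sm hs ACo.x
  have h2 : ∀ σ τ a α q, (vv' (aunit k (pv τ)) a * ww q α + vv q a * ww' (aunit k (pv τ)) α) *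
      pd (pv σ) (cmp X ACo.x) q = (vv' (aunit k (pv σ)) a * ww q α + vv q a * ww' (aunit k (pv σ)) α) *
      pd (pv τ) (cmp X ACo.x) q := by
    intro σ τ a α q
    have key : ∀ σ τ, pd (pv τ) (pd (pv σ) (cmp X (co a α))) q =
      (vv' (aunit k (pv τ)) a * ww q α + vv q a * ww' (aunit k (pv τ)) α) *
      pd (pv σ) (cmp X ACo.x) q + vv q a * ww q α * pd (pv τ) (pd (pv σ) (cmp X ACo.x)) q := by
      intro σ τ
      have e : pd (pv σ) (cmp X (co a α)) = fun q => vv q a * ww q α * pd (pv σ) (cmp X ACo.x) q := by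
        funext q; exact h1 σ a α q
      rw [e]
      obtain ⟨g1, g2⟩ := vvww_deriv q (aunit k (pv τ)) a α
      rw [pd, fderiv_fun_mul g1 ((hxs.pd _).diff q)]
      simp [g2, pd]
      ring
    have e1 := key σ τ
    have e2 := key τ σ
    rw [pd_comm (cmp_sm hs _), e2, pd_comm hxs] at e1
    linarith
  have h3 : ∀ σ q, pd (pv σ) (cmp X ACo.x) q = 0 := by
    intro σ q
    cases σ with
    | none =>
      have := h2 none (some ⟨0, hk⟩) false (some ⟨0, hk⟩) q
      simpa [vv, vv', ww, ww', aunit, pv] using this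
    | some i =>
      have := h2 (some i) none true none q
      simpa [vv, vv', ww, ww', aunit, pv] using this
  funext q
  rw [h1, h3]; simp

lemma eqs_of_sym {k : ℕ} {X : APt k → APt k} (hX : X ∈ aSym k) (a : Bool)
    (α : Option (Fin k)) (q : APt k) :
    YY X a α q = vv' (X q) a * ww q α + vv q a * ww' (X q) α + vv q a * ww q α * YY X false none q := by
  obtain ⟨hs, hX⟩ := hX
  have := hX (aDx k) aDx_sm (fun q => Submodule.subset_span (by simp)) q
  rw [mem_aDist] at this
  have := this a α
  simp only [aBr, Pi.sub_apply, fderiv_cmp hs, fderiv_cmp aDx_sm] at this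
  have e : ∀ a α, cmp (aDx k) (co a α) = fun q => vv q a * ww q α := by
    intro a α; funext q; exact aDx_co q a α
  have e0 := e false none
  rw [e, (vvww_deriv q (X q) a α).2, show (ACo.x : ACo k) = co false none from rfl, e0,
    (vvww_deriv q (X q) false none).2] at this
  have z1 : vv' (X q) false = 0 := rfl
  have z2 : ww' (X q) none = 0 := rfl
  rw [z1, z2] at this
  unfold YY
  linarith

lemma sym_of_eqs {k : ℕ} {X : APt k → APt k} (hs : ContDiff ℝ (⊤ : ℕ∞) X)
    (h1 : ∀ a α σ, pd (pv σ) (cmp X (co a α)) = 0)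
    (h2 : ∀ a α q, YY X a α q = vv' (X q) a * ww q α + vv q a * ww' (X q) α +
      vv q a * ww q α * YY X false none q) : X ∈ aSym k := by
  refine ⟨hs, fun W hW hWD q => ?_⟩
  rw [mem_aDist]
  intro a α
  have e : ∀ a α, cmp W (co a α) = fun q => vv q a * ww q α * cmp W ACo.x q := by
    intro a α
    funext q
    exact (mem_aDist q (W q)).1 (hWD q) a α
  have hx := (cmp_sm hW ACo.x).diff q
  have d : ∀ a α, fderiv ℝ (cmp X (co a α)) q (W q) = W q ACo.x * YY X a α q := by
    intro a α
    conv_lhs => rw [decomp_of q (W q) ((mem_aDist q (W q)).1 (hWD q))]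
    rw [map_add, map_smul, map_sum]
    have : ∀ σ, fderiv ℝ (cmp X (co a α)) q (aunit k (pv σ)) = 0 := fun σ => congrFun (h1 a α σ) q
    simp [this, YY, -Fintype.sum_option]
  simp only [aBr, Pi.sub_apply, fderiv_cmp hs, fderiv_cmp hW]
  have d0 := d false none
  simp only [co] at d0
  obtain ⟨g1, g2⟩ := vvww_deriv q (X q) a α
  rw [d0, d, e, fderiv_fun_mul g1 hx]
  simp [g2]
  rw [h2]
  simp [cmp]
  ring

lemma sym_ext {k : ℕ} {X Z : APt k → APt k} (hX : X ∈ aSym k) (hZ : Z ∈ aSym k)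
    (h : ∀ a α, cmp X (co a α) = cmp Z (co a α)) : X = Z := by
  have hY : ∀ a α q, YY X a α q = YY Z a α q := by
    intro a α q; unfold YY; rw [h]
  funext q i
  revert i
  apply aco_cases
  · intro a α; exact congrFun (h a α) q
  · intro σ
    cases σ with
    | none =>
      have e1 := eqs_of_sym hX true none q
      have e2 := eqs_of_sym hZ true none q
      simp only [hY, vv', vv, ww, ww'] at e1 e2
      simp only [pv]; linarith
    | some i =>
      have e1 := eqs_of_sym hX false (some i) q
      have e2 := eqs_of_sym hZ false (some i) q
      simp only [hY, vv', vv, ww, ww'] at e1 e2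
      simp only [pv]; linarith

lemma aBr_sym {k : ℕ} {X Z : APt k → APt k} (hX : X ∈ aSym k) (hZ : Z ∈ aSym k) :
    aBr k X Z ∈ aSym k := by
  have hb : ∀ {U V : APt k → APt k}, ContDiff ℝ (⊤ : ℕ∞) U → ContDiff ℝ (⊤ : ℕ∞) V →
      ContDiff ℝ (⊤ : ℕ∞) (aBr k U V) := by
    intro U V hU hV
    exact hU.lieBracket_vectorField hV (by simp)
  refine ⟨hb hX.1 hZ.1, fun W hW hWD q => ?_⟩
  have := leibniz_identity_lieBracket (𝕜 := ℝ) (n := (⊤ : ℕ∞)) (x := q)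
    (by simp only [minSmoothness_of_isRCLikeNormedField]; exact two_le_top) (hX.1.contDiffAt) (hZ.1.contDiffAt) (ContDiff.contDiffAt hW)
  have e1 := hX.2 _ (hb hZ.1 hW) (hZ.2 W hW hWD) q
  have e2 := hZ.2 _ (hb hX.1 hW) (hX.2 W hW hWD) q
  have : aBr k (aBr k X Z) W q = aBr k X (aBr k Z W) q - aBr k Z (aBr k X W) q := by
    change lieBracket ℝ (lieBracket ℝ X Z) W q = lieBracket ℝ X (lieBracket ℝ Z W) q -
      lieBracket ℝ Z (lieBracket ℝ X W) q
    rw [this]; simp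
  rw [this]
  exact Submodule.sub_mem _ e1 e2



/-! ### Extracting the equations -/

/-- Change of the velocity coordinates. -/
def setp {k : ℕ} (q : APt k) (u t : ℝ) (j : Fin k) : APt k
  | ACo.p0 => u
  | ACo.p i => if i = j then t else 0
  | ACo.x => q ACo.x
  | ACo.y0 => q ACo.y0
  | ACo.y i => q (ACo.y i)
  | ACo.z i => q (ACo.z i)

lemma setp_eq {k : ℕ} (q : APt k) (u t : ℝ) (j : Fin k) :
    setp q u t j = q + ∑ σ : Option (Fin k), (setp q u t j (pv σ) - q (pv σ)) • aunit k (pv σ) := by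
  funext i
  cases i <;> simp [setp, pv, aunit, Finset.sum_apply]

lemma shift_const {k : ℕ} {f : APt k → ℝ} (hf : Sm f) (h : ∀ σ, pd (pv σ) f = 0)
    (r : Option (Fin k) → ℝ) (q : APt k) : f (q + ∑ σ, r σ • aunit k (pv σ)) = f q := by
  set s := ∑ σ, r σ • aunit k (pv σ) with hs
  have hd : ∀ t : ℝ, HasDerivAt (fun t : ℝ => f (q + t • s)) 0 t := by
    intro t
    have h1 : HasDerivAt (fun t : ℝ => q + t • s) s t := by
      simpa using ((hasDerivAt_id t).smul_const s).const_add q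
    have h2 := (hf.diff (q + t • s)).hasFDerivAt.comp_hasDerivAt t h1
    have h3 : fderiv ℝ f (q + t • s) s = 0 := by
      rw [hs, map_sum]
      refine Finset.sum_eq_zero fun σ _ => ?_
      have := congrFun (h σ) (q + t • s)
      rw [pd] at this
      rw [map_smul, ← hs, this]; simp
    rw [h3] at h2
    exact h2
  have := is_const_of_deriv_eq_zero (f := fun t : ℝ => f (q + t • s))
    (fun t => (hd t).differentiableAt) (fun t => (hd t).deriv) 1 0
  simpa using this

lemma pd_setp {k : ℕ} {f : APt k → ℝ} (hf : Sm f) (h : ∀ σ, pd (pv σ) f = 0)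
    (q : APt k) (u t : ℝ) (j : Fin k) (i : ACo k) : pd i f (setp q u t j) = pd i f q := by
  rw [setp_eq]
  apply shift_const (hf.pd i)
  intro σ
  rw [pd_comm hf, h, pd_zero]

lemma YY_setp {k : ℕ} {X : APt k → APt k} (hs : ContDiff ℝ (⊤ : ℕ∞) X)
    (h : ∀ a α σ, pd (pv σ) (cmp X (co a α)) = 0) (a : Bool) (α : Option (Fin k))
    (q : APt k) (u t : ℝ) (j : Fin k) :
    YY X a α (setp q u t j) = pd (co false none) (cmp X (co a α)) q +
      t * pd (co false (some j)) (cmp X (co a α)) q +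
      u * (pd (co true none) (cmp X (co a α)) q + t * pd (co true (some j)) (cmp X (co a α)) q) := by
  have e : ∀ i, fderiv ℝ (cmp X (co a α)) (setp q u t j) (aunit k i) = pd i (cmp X (co a α)) q :=
    fun i => pd_setp (cmp_sm hs _) (h a α) q u t j i
  have e1 : YY X a α (setp q u t j) = fderiv ℝ (cmp X (co a α)) (setp q u t j)
    (aDx k (setp q u t j)) := rfl
  rw [e1, aDx]
  simp only [map_add, map_smul, map_sum, e]
  have s1 : ∀ i, setp q u t j (ACo.p i) = if i = j then t else 0 := fun i => rfl
  have s2 : setp q u t j (ACo.p0) = u := rfl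
  simp only [s1, s2, smul_eq_mul, co, mul_ite, ite_mul, zero_mul, mul_zero, Finset.sum_ite_eq',
    Finset.mem_univ, if_true]
  ring

lemma key_poly {k : ℕ} {X : APt k → APt k} (hX : X ∈ aSym k)
    (h : ∀ a α σ, pd (pv σ) (cmp X (co a α)) = 0) (T : Bool → Option (Fin k) → Bool → Option (Fin k) → ℝ)
    (q : APt k) (hT : ∀ a α b β, T a α b β = pd (co b β) (cmp X (co a α)) q) (i j : Fin k)
    (S : Bool → Option (Fin k) → ℝ → ℝ → ℝ)
    (hS : ∀ a α u t, S a α u t = T a α false none + t * T a α false (some j) +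
      u * (T a α true none + t * T a α true (some j))) (u t w : ℝ) (hw : w = if i = j then t else 0) :
    S true (some i) u t = w * S true none u t + u * S false (some i) u t
      - u * w * S false none u t := by
  have hY : ∀ a α, S a α u t = YY X a α (setp q u t j) := by
    intro a α
    rw [YY_setp hX.1 h, hS]; simp only [hT]
  simp only [hY]
  have e1 := eqs_of_sym hX true (some i) (setp q u t j)
  have e2 := eqs_of_sym hX true none (setp q u t j)
  have e3 := eqs_of_sym hX false (some i) (setp q u t j)
  have s1 : setp q u t j (ACo.p i) = w := by rw [hw]; rfl
  have s2 : setp q u t j (ACo.p0) = u := rfl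
  simp only [vv, vv', ww, ww', s1, s2] at e1 e2 e3
  rw [e1, e2, e3]; ring

lemma four_fam {k : ℕ} {X : APt k → APt k} (hX : X ∈ aSym k)
    (h : ∀ a α σ, pd (pv σ) (cmp X (co a α)) = 0) (T : Bool → Option (Fin k) → Bool → Option (Fin k) → ℝ)
    (q : APt k) (hT : ∀ a α b β, T a α b β = pd (co b β) (cmp X (co a α)) q) (i j : Fin k) :
    (T true (some i) false none = 0 ∧ T false (some i) true none = 0 ∧
      T true (some i) true none = T false (some i) false none) ∧
    (i ≠ j → T true (some i) false (some j) = 0 ∧ T false (some i) true (some j) = 0 ∧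
      T true (some i) true (some j) = T false (some i) false (some j)) ∧
    (T true none false (some i) = 0 ∧ T false none true (some i) = 0 ∧
      T true none true (some i) = T false none false (some i) ∧
      T true (some i) false (some i) = T true none false none ∧
      T false (some i) true (some i) = T false none true none ∧
      T true (some i) true (some i) = T false (some i) false (some i) + T true none true none
        - T false none false none) := by
  have K : ∀ (j : Fin k) (u t w : ℝ), (w = if i = j then t else 0) → _ :=
    fun j u t w hw => key_poly hX h T q hT i j _ (fun a α u t => rfl) u t w hw
  refine ⟨?_, ?_, ?_⟩
  · have a0 := K j 0 0 0 (by simp)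
    have a1 := K j 1 0 0 (by simp)
    have a2 := K j (-1) 0 0 (by simp)
    refine ⟨?_, ?_, ?_⟩ <;> linarith
  · intro hij
    have a0 := K j 0 0 0 (by simp)
    have a1 := K j 1 0 0 (by simp)
    have a2 := K j (-1) 0 0 (by simp)
    have b0 := K j 0 1 0 (by simp [hij])
    have b1 := K j 1 1 0 (by simp [hij])
    have b2 := K j (-1) 1 0 (by simp [hij])
    refine ⟨?_, ?_, ?_⟩ <;> linarith
  · have a0 := K i 0 0 0 (by simp)
    have a1 := K i 1 0 0 (by simp)
    have a2 := K i (-1) 0 0 (by simp)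
    have b0 := K i 0 1 1 (by simp)
    have b1 := K i 1 1 1 (by simp)
    have b2 := K i (-1) 1 1 (by simp)
    have c0 := K i 0 (-1) (-1) (by simp)
    have c1 := K i 1 (-1) (-1) (by simp)
    have c2 := K i (-1) (-1) (-1) (by simp)
    refine ⟨?_, ?_, ?_, ?_, ?_, ?_⟩ <;> linarith

/-- The Grassmannian system. -/
structure Sys {k : ℕ} (X : Bool → Option (Fin k) → APt k → ℝ) : Prop where
  sm : ∀ a α, Sm (X a α)
  p : ∀ a α σ, pd (pv σ) (X a α) = 0
  Z : ∀ a α b β, a ≠ b → α ≠ β → pd (co b β) (X a α) = 0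
  A : ∀ a b α β, a ≠ b → pd (co b α) (X a α) = pd (co b β) (X a β)
  D : ∀ a b α β, α ≠ β → pd (co a β) (X a α) = pd (co b β) (X b α)
  H : ∀ a b α β, pd (co a α) (X a α) =
    pd (co b α) (X b α) + pd (co a β) (X a β) - pd (co b β) (X b β)

lemma sys_of_sym {k : ℕ} (hk : 1 ≤ k) {X : APt k → APt k} (hX : X ∈ aSym k) :
    Sys (fun a α => cmp X (co a α)) := by
  have hp := fun a α σ => p_const_of_sym hk hX a α σ
  have F := fun q i j => four_fam hX hp (fun a α b β => pd (co b β) (cmp X (co a α)) q) q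
    (fun a α b β => rfl) i j
  refine ⟨fun a α => cmp_sm hX.1 _, hp, ?_, ?_, ?_, ?_⟩
  · intro a α b β hab hαβ
    funext q
    rcases α with _ | i <;> rcases β with _ | j
    · exact absurd rfl hαβ
    · have := F q j j
      cases a <;> cases b <;> simp_all
    · have := F q i i
      cases a <;> cases b <;> simp_all
    · have := F q i j
      cases a <;> cases b <;> simp_all
  · intro a b α β hab
    have base : ∀ i, pd (co b (some i)) (cmp X (co a (some i))) = pd (co b none) (cmp X (co a none)) := by
      intro i
      funext q
      have := (F q i i).2.2
      cases a <;> cases b <;> simp_all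
    rcases α with _ | i <;> rcases β with _ | j <;> first | rfl | simp only [base]
  · intro a b α β hαβ
    have base : ∀ a, pd (co a β) (cmp X (co a α)) = pd (co false β) (cmp X (co false α)) := by
      intro a
      cases a
      · rfl
      funext q
      rcases α with _ | i <;> rcases β with _ | j
      · exact absurd rfl hαβ
      · exact (F q j j).2.2.2.2.1
      · exact (F q i i).1.2.2
      · exact ((F q i j).2.1 (by simpa using hαβ)).2.2
    rw [base a, base b]
  · intro a b α β
    funext q
    have base : ∀ α, pd (co true α) (cmp X (co true α)) q = pd (co false α) (cmp X (co false α)) q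
        + pd (co true none) (cmp X (co true none)) q - pd (co false none) (cmp X (co false none)) q := by
      intro α
      rcases α with _ | i
      · ring
      · exact (F q i i).2.2.2.2.2.2.2
    simp only [Pi.add_apply, Pi.sub_apply]
    cases a <;> cases b <;> (try simp only [base α, base β]) <;> ring



/-! ### Solving the system -/

lemma bool_other {a b c : Bool} (h : a ≠ b) (h2 : c ≠ b) : c = a := by
  cases a <;> cases b <;> cases c <;> simp_all

lemma sm_add {k : ℕ} {f g : APt k → ℝ} (hf : Sm f) (hg : Sm g) : Sm (f + g) :=
  ContDiff.add hf hg

lemma Sys.third {k : ℕ} [Nontrivial (Option (Fin k))] {X : Bool → Option (Fin k) → APt k → ℝ}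
    (S : Sys X) (a b : Bool) (hab : a ≠ b)
    (γ α : Option (Fin k)) (i : ACo k) : pd i (pd (co a γ) (pd (co b α) (X a α))) = 0 := by
  have sm := S.sm
  -- commuting third derivatives
  have c12 : ∀ (i j l : ACo k) a α, pd i (pd j (pd l (X a α))) = pd j (pd i (pd l (X a α))) :=
    fun i j l a α => pd_comm ((sm a α).pd l) i j
  have c23 : ∀ (i j l : ACo k) a α, pd i (pd j (pd l (X a α))) = pd i (pd l (pd j (X a α))) :=
    fun i j l a α => by rw [pd_comm (sm a α) j l]
  have z : ∀ (i j : ACo k), pd i (pd j (0 : APt k → ℝ)) = 0 := by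
    intro i j; rw [pd_zero, pd_zero]
  revert i
  apply aco_cases
  · intro c δ
    by_cases hc : c = b
    · subst hc
      obtain ⟨α', hα'⟩ := exists_ne δ
      rw [S.A a c α α' hab, c12, c23, S.Z a α' c δ hab hα', z]
    · have hca : c = a := bool_other hab hc
      subst hca
      by_cases hδ : δ = γ
      · subst hδ
        obtain ⟨α', hα'⟩ := exists_ne δ
        rw [S.A c b α α' hab, c23, S.D c b α' δ hα', c23, c12, c23,
          S.Z b α' c δ hab.symm hα', z]
      · have hδ' : γ ≠ δ := fun h => hδ h.symm
        -- the quantity `T`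
        have hT : pd (co c δ) (pd (co c γ) (pd (co b δ) (X c δ))) =
            - pd (co c δ) (pd (co c γ) (pd (co b δ) (X c δ))) := by
          have e1 : pd (co c δ) (pd (co c γ) (pd (co b δ) (X c δ))) =
              pd (co b δ) (pd (co c γ) (pd (co c δ) (X c δ))) := by
            rw [c23, c12, c23, c12, c23, c12]
          have e2 : pd (co b δ) (pd (co c γ) (pd (co b δ) (X b δ))) = 0 := by
            rw [c23, S.Z b δ c γ hab.symm hδ, z]
          have e3 : pd (co b δ) (pd (co c γ) (pd (co c γ) (X c γ))) = 0 := by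
            rw [c12, c23, S.Z c γ b δ hab hδ', z]
          have e4 : pd (co b δ) (pd (co c γ) (pd (co b γ) (X b γ))) =
              pd (co c δ) (pd (co c γ) (pd (co b δ) (X c δ))) := by
            rw [c23, S.A b c γ δ hab.symm, c23, S.D b c δ γ hδ, c12, c23, c12, c23, c12, c23]
          have e5 : pd (co b δ) (pd (co c γ) (pd (co c δ) (X c δ))) =
              pd (co b δ) (pd (co c γ) (pd (co b δ) (X b δ))) +
              pd (co b δ) (pd (co c γ) (pd (co c γ) (X c γ))) -
              pd (co b δ) (pd (co c γ) (pd (co b γ) (X b γ))) := by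
            have s1 := (sm b δ).pd (co b δ)
            have s2 := (sm c γ).pd (co c γ)
            have s3 := (sm b γ).pd (co b γ)
            rw [S.H c b δ γ, pd_sub (sm_add s1 s2) s3, pd_add s1 s2,
              pd_sub (sm_add (s1.pd _) (s2.pd _)) (s3.pd _), pd_add (s1.pd _) (s2.pd _)]
          rw [← e4]
          conv_lhs => rw [e4, e1, e5, e2, e3]
          simp
        rw [S.A c b α δ hab]
        funext q
        have := congrFun hT q
        simp only [Pi.neg_apply, Pi.zero_apply] at this ⊢
        linarith
  · intro σ
    rw [c12, c23, S.p, z]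


lemma const_of_pd {k : ℕ} {f : APt k → ℝ} (hf : Sm f) (h : ∀ i, pd i f = 0) (q : APt k) :
    f q = f 0 := by
  have : f = fun _ => f 0 := by
    refine eq_of_pd hf contDiff_const (fun i q => ?_) rfl
    rw [h]; simp [pd]
  exact congrFun this q

lemma Sys.second {k : ℕ} [Nontrivial (Option (Fin k))] {X : Bool → Option (Fin k) → APt k → ℝ}
    (S : Sys X) : ∃ E : Option (Fin k) → Bool → ℝ, ∀ a α b β c δ q,
      pd (co c δ) (pd (co b β) (X a α)) q =
        (if a = b ∧ δ = α then E β c else 0) + (if c = a ∧ α = β then E δ b else 0) := by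
  have sm := S.sm
  have cm : ∀ (i j : ACo k) a α, pd i (pd j (X a α)) = pd j (pd i (X a α)) :=
    fun i j a α => pd_comm (sm a α) i j
  have F1 : ∃ E : Option (Fin k) → Bool → ℝ, ∀ a b, a ≠ b → ∀ γ α q,
      pd (co a γ) (pd (co b α) (X a α)) q = E γ b := by
    refine ⟨fun γ b => pd (co (!b) γ) (pd (co b none) (X (!b) none)) 0, fun a b hab γ α q => ?_⟩
    have ha : a = !b := by cases a <;> cases b <;> simp_all
    beta_reduce
    rw [S.A a b α none hab, ← ha]
    exact const_of_pd (((sm _ _).pd _).pd _) (S.third a b hab γ none) q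
  obtain ⟨E, F1⟩ := F1
  refine ⟨E, ?_⟩
  have F1' : ∀ a b, a ≠ b → ∀ γ α q, pd (co b γ) (pd (co b α) (X a α)) q = 0 := by
    intro a b hab γ α q
    obtain ⟨α', hα'⟩ := exists_ne γ
    rw [S.A a b α α' hab, cm, S.Z a α' b γ hab hα', pd_zero]; rfl
  have F2 : ∀ a c γ α, γ ≠ α → ∀ q, pd (co c α) (pd (co a γ) (X a α)) q = E γ c := by
    intro a c γ α h q
    have hc : (!c) ≠ c := by cases c <;> simp
    rw [S.D a (!c) α γ h.symm, cm, F1 _ _ hc]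
  have F2' : ∀ a c γ α δ, γ ≠ α → δ ≠ α → ∀ q, pd (co c δ) (pd (co a γ) (X a α)) q = 0 := by
    intro a c γ α δ h h2 q
    have hc : (!c) ≠ c := by cases c <;> simp
    rw [S.D a (!c) α γ h.symm, cm, S.Z _ _ _ _ hc h2.symm, pd_zero]; rfl
  have F3 : ∀ a c α, c ≠ a → ∀ q, pd (co c α) (pd (co a α) (X a α)) q = E α c := by
    intro a c α h q
    rw [cm, F1 _ _ h.symm]
  have F3' : ∀ a c α δ, c ≠ a → δ ≠ α → ∀ q, pd (co c δ) (pd (co a α) (X a α)) q = 0 := by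
    intro a c α δ h h2 q
    rw [cm, S.Z _ _ _ _ h.symm h2.symm, pd_zero]; rfl
  have F4 : ∀ a α δ, δ ≠ α → ∀ q, pd (co a δ) (pd (co a α) (X a α)) q = E δ a := by
    intro a α δ h q
    rw [cm, F2 _ _ _ _ h]
  have F5 : ∀ a α q, pd (co a α) (pd (co a α) (X a α)) q = E α a + E α a := by
    intro a α q
    have hc : a ≠ (!a) := by cases a <;> simp
    obtain ⟨β, hβ⟩ := exists_ne α
    have s1 := (sm (!a) α).pd (co (!a) α)
    have s2 := (sm a β).pd (co a β)
    have s3 := (sm (!a) β).pd (co (!a) β)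
    rw [S.H a (!a) α β, pd_sub (sm_add s1 s2) s3, pd_add s1 s2]
    simp only [Pi.add_apply, Pi.sub_apply]
    rw [F3 _ _ _ hc, F4 _ _ _ hβ.symm, F3' _ _ _ _ hc hβ.symm]; ring
  intro a α b β c δ q
  by_cases hab : a = b
  · subst hab
    by_cases hαβ : α = β
    · subst hαβ
      by_cases hc : c = a
      · subst hc
        by_cases hδ : δ = α
        · subst hδ; simp [F5]
        · simp [hδ, F4 _ _ _ hδ]
      · by_cases hδ : δ = α
        · subst hδ; simp [F3 _ _ _ hc, hc]
        · simp [hδ, hc, F3' _ _ _ _ hc hδ]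
    · have hβ : β ≠ α := fun h => hαβ h.symm
      by_cases hδ : δ = α
      · subst hδ; simp [hαβ, F2 _ _ _ _ hβ]
      · simp [hδ, hαβ, F2' _ _ _ _ _ hβ hδ]
  · by_cases hαβ : α = β
    · subst hαβ
      by_cases hc : c = b
      · subst hc
        have : ¬ c = a := fun h => hab h.symm
        simp [hab, this, F1' _ _ hab]
      · have hca : c = a := bool_other hab hc
        subst hca
        simp [hab, F1 _ _ hab]
    · simp [hab, hαβ, S.Z a α b β hab hαβ, pd_zero]



/-! ### The model -/

abbrev Ix (k : ℕ) := Bool ⊕ Option (Fin k)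

def mat {k : ℕ} (q : APt k) : Matrix Bool (Option (Fin k)) ℝ := Matrix.of fun a α => q (co a α)

lemma mat_apply {k : ℕ} (q : APt k) (a : Bool) (α : Option (Fin k)) : mat q a α = q (co a α) := rfl

lemma mat_line {k : ℕ} (q v : APt k) (t : ℝ) : mat (q + t • v) = mat q + t • mat v := by
  ext a α; simp [mat_apply]

def Gm {k : ℕ} (M : Matrix (Ix k) (Ix k) ℝ) (m : Matrix Bool (Option (Fin k)) ℝ) :
    Matrix Bool (Option (Fin k)) ℝ :=
  -(M.toBlocks₁₂ + M.toBlocks₁₁ * m - m * M.toBlocks₂₂ - m * M.toBlocks₂₁ * m)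

def dG {k : ℕ} (M : Matrix (Ix k) (Ix k) ℝ) (m h : Matrix Bool (Option (Fin k)) ℝ) :
    Matrix Bool (Option (Fin k)) ℝ :=
  -(M.toBlocks₁₁ * h - h * M.toBlocks₂₂ - h * M.toBlocks₂₁ * m - m * M.toBlocks₂₁ * h)

lemma Gm_line {k : ℕ} (M : Matrix (Ix k) (Ix k) ℝ) (m h : Matrix Bool (Option (Fin k)) ℝ) (t : ℝ) :
    Gm M (m + t • h) = Gm M m + t • dG M m h + t ^ 2 • (h * M.toBlocks₂₁ * h) := by
  simp only [Gm, dG, Matrix.mul_add, Matrix.add_mul, Matrix.mul_smul, Matrix.smul_mul]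
  module

lemma dG_line {k : ℕ} (M : Matrix (Ix k) (Ix k) ℝ) (m h n : Matrix Bool (Option (Fin k)) ℝ) (t : ℝ) :
    dG M (m + t • n) h = dG M m h + t • (h * M.toBlocks₂₁ * n + n * M.toBlocks₂₁ * h) := by
  simp only [dG, Matrix.mul_add, Matrix.add_mul, Matrix.mul_smul, Matrix.smul_mul]
  module

lemma fderiv_of_line {k : ℕ} {f : APt k → ℝ} (hf : Sm f) (q v : APt k) (c0 c1 c2 : ℝ)
    (h : ∀ t : ℝ, f (q + t • v) = c0 + t * c1 + t ^ 2 * c2) : fderiv ℝ f q v = c1 := by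
  have h1 : HasDerivAt (fun t : ℝ => q + t • v) v 0 := by
    simpa using ((hasDerivAt_id (0 : ℝ)).smul_const v).const_add q
  have h2 : HasDerivAt (fun t : ℝ => f (q + t • v)) (fderiv ℝ f q v) 0 := by
    have h0 : HasFDerivAt f (fderiv ℝ f q) (q + (0 : ℝ) • v) := by
      simpa using (hf.diff q).hasFDerivAt
    exact h0.comp_hasDerivAt (0 : ℝ) h1
  have h3 : HasDerivAt (fun t : ℝ => c0 + t * c1 + t ^ 2 * c2) c1 0 := by
    have := ((hasDerivAt_const (0 : ℝ) c0).add ((hasDerivAt_id (0 : ℝ)).mul_const c1)).add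
      ((hasDerivAt_pow 2 (0 : ℝ)).mul_const c2)
    refine HasDerivAt.congr_deriv (f := fun t : ℝ => c0 + t * c1 + t ^ 2 * c2) this ?_
    simp
  have e : (fun t : ℝ => f (q + t • v)) = fun t : ℝ => c0 + t * c1 + t ^ 2 * c2 := funext h
  rw [e] at h2
  exact h2.unique h3

lemma mat_sm {k : ℕ} (a : Bool) (α : Option (Fin k)) : Sm (fun q : APt k => mat q a α) :=
  contDiff_apply _ _ _

lemma Gm_sm {k : ℕ} (M : Matrix (Ix k) (Ix k) ℝ) (a : Bool) (α : Option (Fin k)) :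
    Sm (fun q => Gm M (mat q) a α) := by
  simp only [Gm, Matrix.neg_apply, Matrix.sub_apply, Matrix.add_apply, Matrix.mul_apply]
  refine ContDiff.neg (((contDiff_const.add ?_).sub ?_).sub ?_)
  · exact ContDiff.sum fun i _ => contDiff_const.mul (mat_sm _ _)
  · exact ContDiff.sum fun i _ => (mat_sm _ _).mul contDiff_const
  · exact ContDiff.sum fun i _ => (ContDiff.sum fun i _ => (mat_sm _ _).mul contDiff_const).mul
      (mat_sm _ _)

lemma dG_sm {k : ℕ} (M : Matrix (Ix k) (Ix k) ℝ) (h) (a : Bool) (α : Option (Fin k)) :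
    Sm (fun q => dG M (mat q) h a α) := by
  simp only [dG, Matrix.neg_apply, Matrix.sub_apply, Matrix.mul_apply]
  refine ContDiff.neg (((contDiff_const.sub contDiff_const).sub ?_).sub ?_)
  · exact ContDiff.sum fun i _ => contDiff_const.mul (mat_sm _ _)
  · exact ContDiff.sum fun i _ => (ContDiff.sum fun i _ => (mat_sm _ _).mul contDiff_const).mul
      contDiff_const

lemma fderiv_Gm {k : ℕ} (M : Matrix (Ix k) (Ix k) ℝ) (a : Bool) (α : Option (Fin k)) (q v : APt k) :
    fderiv ℝ (fun q => Gm M (mat q) a α) q v = dG M (mat q) (mat v) a α := by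
  apply fderiv_of_line (Gm_sm M a α) q v (Gm M (mat q) a α) _
    ((mat v * M.toBlocks₂₁ * mat v) a α)
  intro t
  rw [mat_line, Gm_line]
  simp

lemma fderiv_dG {k : ℕ} (M : Matrix (Ix k) (Ix k) ℝ) (h) (a : Bool) (α : Option (Fin k))
    (q v : APt k) :
    fderiv ℝ (fun q => dG M (mat q) h a α) q v =
      (h * M.toBlocks₂₁ * mat v + mat v * M.toBlocks₂₁ * h) a α := by
  apply fderiv_of_line (dG_sm M h a α) q v (dG M (mat q) h a α) _ 0
  intro t
  rw [mat_line, dG_line]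
  simp
  ring

/-- The vector field attached to a matrix. -/
noncomputable def phi {k : ℕ} (M : Matrix (Ix k) (Ix k) ℝ) (q : APt k) : APt k
  | ACo.x => Gm M (mat q) false none
  | ACo.y0 => Gm M (mat q) true none
  | ACo.y i => Gm M (mat q) false (some i)
  | ACo.z i => Gm M (mat q) true (some i)
  | ACo.p0 => dG M (mat q) (mat (aDx k q)) true none -
      q ACo.p0 * dG M (mat q) (mat (aDx k q)) false none
  | ACo.p i => dG M (mat q) (mat (aDx k q)) false (some i) -
      q (ACo.p i) * dG M (mat q) (mat (aDx k q)) false none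

lemma phi_co {k : ℕ} (M : Matrix (Ix k) (Ix k) ℝ) (q : APt k) (a : Bool) (α : Option (Fin k)) :
    phi M q (co a α) = Gm M (mat q) a α := by
  cases a <;> cases α <;> rfl

lemma cmp_phi {k : ℕ} (M : Matrix (Ix k) (Ix k) ℝ) (a : Bool) (α : Option (Fin k)) :
    cmp (phi M) (co a α) = fun q => Gm M (mat q) a α := by
  funext q; exact phi_co M q a α

lemma phi_sm {k : ℕ} (M : Matrix (Ix k) (Ix k) ℝ) : ContDiff ℝ (⊤ : ℕ∞) (phi M) := by
  have hd : ∀ a α, Sm (fun q => dG M (mat q) (mat (aDx k q)) a α) := by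
    intro a α
    simp only [← fderiv_Gm]
    have : ContDiff ℝ (⊤ : ℕ∞) (fderiv ℝ (fun q => Gm M (mat q) a α)) :=
      ContDiff.fderiv_right (Gm_sm M a α) (by simp)
    exact this.clm_apply aDx_sm
  rw [contDiff_pi]
  apply aco_cases
  · intro a α
    simp only [phi_co]
    exact Gm_sm M a α
  · intro σ
    cases σ with
    | none => exact (hd _ _).sub (ContDiff.mul (contDiff_apply _ _ _) (hd _ _))
    | some i => exact (hd _ _).sub (ContDiff.mul (contDiff_apply _ _ _) (hd _ _))

lemma YY_phi {k : ℕ} (M : Matrix (Ix k) (Ix k) ℝ) (a : Bool) (α : Option (Fin k)) (q : APt k) :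
    YY (phi M) a α q = dG M (mat q) (mat (aDx k q)) a α := by
  rw [YY, cmp_phi, fderiv_Gm]

lemma dG_rank_one {k : ℕ} (M : Matrix (Ix k) (Ix k) ℝ) (q : APt k) :
    ∃ s : Bool → ℝ, ∃ u : Option (Fin k) → ℝ, ∀ a α,
      dG M (mat q) (mat (aDx k q)) a α = -(s a * ww q α - vv q a * u α) := by
  have : mat (aDx k q) = Matrix.vecMulVec (vv q) (ww q) := by
    ext a α
    rw [mat_apply, aDx_co]; rfl
  rw [this]
  refine ⟨M.toBlocks₁₁.mulVec (vv q) - (mat q * M.toBlocks₂₁).mulVec (vv q),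
    Matrix.vecMul (ww q) M.toBlocks₂₂ + Matrix.vecMul (ww q) (M.toBlocks₂₁ * mat q), ?_⟩
  intro a α
  rw [dG, Matrix.mul_assoc (Matrix.vecMulVec (vv q) (ww q))]
  simp only [Matrix.mul_vecMulVec, Matrix.vecMulVec_mul, Matrix.neg_apply, Matrix.sub_apply,
    Matrix.vecMulVec_apply, Pi.sub_apply, Pi.add_apply]
  ring

lemma phi_mem {k : ℕ} (M : Matrix (Ix k) (Ix k) ℝ) : phi M ∈ aSym k := by
  refine sym_of_eqs (phi_sm M) ?_ ?_
  · intro a α σ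
    funext q
    have : mat (aunit k (pv σ)) = 0 := by
      ext a α; rw [mat_apply, aunit_pv_co]; rfl
    rw [cmp_phi, pd, fderiv_Gm, this]
    simp [dG]
  · intro a α q
    obtain ⟨s, u, h⟩ := dG_rank_one M q
    simp only [YY_phi]
    rcases a with _ | _ <;> rcases α with _ | i <;> simp only [vv', ww', phi, h, vv, ww] <;> ring

lemma phi_bracket {k : ℕ} (M N : Matrix (Ix k) (Ix k) ℝ) :
    phi ⁅M, N⁆ = aBr k (phi M) (phi N) := by
  apply sym_ext (phi_mem _) (aBr_sym (phi_mem M) (phi_mem N))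
  intro a α
  funext q
  have e : ∀ M, mat (phi M q) = Gm M (mat q) := by
    intro M; ext a α; rw [mat_apply, phi_co]
  have : cmp (aBr k (phi M) (phi N)) (co a α) q =
      (dG N (mat q) (Gm M (mat q)) - dG M (mat q) (Gm N (mat q))) a α := by
    rw [cmp, aBr, Pi.sub_apply, fderiv_cmp (phi_sm _), fderiv_cmp (phi_sm _), cmp_phi, cmp_phi,
      fderiv_Gm, fderiv_Gm, e, e]
    rfl
  rw [this, cmp_phi]
  beta_reduce
  refine congrFun (congrFun ?_ a) α
  rw [← Matrix.fromBlocks_toBlocks M, ← Matrix.fromBlocks_toBlocks N, Ring.lie_def,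
    Matrix.fromBlocks_multiply, Matrix.fromBlocks_multiply]
  generalize M.toBlocks₁₁ = A
  generalize M.toBlocks₁₂ = B
  generalize M.toBlocks₂₁ = C
  generalize M.toBlocks₂₂ = D
  generalize N.toBlocks₁₁ = A'
  generalize N.toBlocks₁₂ = B'
  generalize N.toBlocks₂₁ = C'
  generalize N.toBlocks₂₂ = D'
  generalize mat q = m
  rw [sub_eq_add_neg, Matrix.fromBlocks_neg, Matrix.fromBlocks_add]
  simp only [Gm, dG, Matrix.toBlocks_fromBlocks₁₁, Matrix.toBlocks_fromBlocks₁₂,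
    Matrix.toBlocks_fromBlocks₂₁, Matrix.toBlocks_fromBlocks₂₂, Matrix.mul_add, Matrix.add_mul,
    Matrix.mul_sub, Matrix.sub_mul, Matrix.mul_neg, Matrix.neg_mul, Matrix.mul_assoc]
  abel

/-- `phi` as a linear map. -/
noncomputable def phiL (k : ℕ) : Matrix (Ix k) (Ix k) ℝ →ₗ[ℝ] (APt k → APt k) where
  toFun := phi
  map_add' M N := by
    have h1 : ∀ m, Gm (M + N) m = Gm M m + Gm N m := by
      intro m
      have t1 : (M + N).toBlocks₁₁ = M.toBlocks₁₁ + N.toBlocks₁₁ := rfl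
      have t2 : (M + N).toBlocks₁₂ = M.toBlocks₁₂ + N.toBlocks₁₂ := rfl
      have t3 : (M + N).toBlocks₂₁ = M.toBlocks₂₁ + N.toBlocks₂₁ := rfl
      have t4 : (M + N).toBlocks₂₂ = M.toBlocks₂₂ + N.toBlocks₂₂ := rfl
      simp only [Gm, t1, t2, t3, t4, Matrix.mul_add, Matrix.add_mul]
      abel
    have h2 : ∀ m h, dG (M + N) m h = dG M m h + dG N m h := by
      intro m h
      have t1 : (M + N).toBlocks₁₁ = M.toBlocks₁₁ + N.toBlocks₁₁ := rfl
      have t3 : (M + N).toBlocks₂₁ = M.toBlocks₂₁ + N.toBlocks₂₁ := rfl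
      have t4 : (M + N).toBlocks₂₂ = M.toBlocks₂₂ + N.toBlocks₂₂ := rfl
      simp only [dG, t1, t3, t4, Matrix.mul_add, Matrix.add_mul]
      abel
    funext q i
    cases i <;> simp only [phi, h1, h2, Pi.add_apply, Matrix.add_apply] <;> ring
  map_smul' c M := by
    have t1 : (c • M).toBlocks₁₁ = c • M.toBlocks₁₁ := rfl
    have t2 : (c • M).toBlocks₁₂ = c • M.toBlocks₁₂ := rfl
    have t3 : (c • M).toBlocks₂₁ = c • M.toBlocks₂₁ := rfl
    have t4 : (c • M).toBlocks₂₂ = c • M.toBlocks₂₂ := rfl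
    have h1 : ∀ m, Gm (c • M) m = c • Gm M m := by
      intro m
      simp only [Gm, t1, t2, t3, t4, Matrix.mul_smul, Matrix.smul_mul]
      module
    have h2 : ∀ m h, dG (c • M) m h = c • dG M m h := by
      intro m h
      simp only [dG, t1, t3, t4, Matrix.mul_smul, Matrix.smul_mul]
      module
    funext q i
    cases i <;> simp only [phi, h1, h2, Pi.smul_apply, Matrix.smul_apply, smul_eq_mul,
      RingHom.id_apply] <;> ring

lemma phiL_apply {k : ℕ} (M : Matrix (Ix k) (Ix k) ℝ) : phiL k M = phi M := rfl

lemma phi_one {k : ℕ} : phi (1 : Matrix (Ix k) (Ix k) ℝ) = 0 := by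
  have t1 : (1 : Matrix (Ix k) (Ix k) ℝ).toBlocks₁₁ = 1 := by
    rw [← Matrix.fromBlocks_one, Matrix.toBlocks_fromBlocks₁₁]
  have t2 : (1 : Matrix (Ix k) (Ix k) ℝ).toBlocks₁₂ = 0 := by
    rw [← Matrix.fromBlocks_one, Matrix.toBlocks_fromBlocks₁₂]
  have t3 : (1 : Matrix (Ix k) (Ix k) ℝ).toBlocks₂₁ = 0 := by
    rw [← Matrix.fromBlocks_one, Matrix.toBlocks_fromBlocks₂₁]
  have t4 : (1 : Matrix (Ix k) (Ix k) ℝ).toBlocks₂₂ = 1 := by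
    rw [← Matrix.fromBlocks_one, Matrix.toBlocks_fromBlocks₂₂]
  funext q i
  cases i <;> simp [phi, Gm, dG, t1, t2, t3, t4]

lemma mat_unit {k : ℕ} (b : Bool) (β : Option (Fin k)) :
    mat (aunit k (co b β)) = Matrix.single b β 1 := by
  ext a α
  rw [mat_apply, aunit_co, Matrix.single_apply]
  congr 1
  simp only [eq_comm]

lemma single_mul' {k : ℕ} {ι : Type*} (b : Bool) (β : Option (Fin k)) (P : Matrix (Option (Fin k)) ι ℝ)
    (a : Bool) (α : ι) :
    ((Matrix.single b β (1 : ℝ) : Matrix Bool (Option (Fin k)) ℝ) * P) a α =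
      if a = b then P β α else 0 := by
  by_cases h : a = b
  · subst h; simp
  · simp [h]

lemma mul_single' {k : ℕ} {ι : Type*} (b : Bool) (β : Option (Fin k)) (P : Matrix ι Bool ℝ)
    (a : ι) (α : Option (Fin k)) :
    (P * (Matrix.single b β (1 : ℝ) : Matrix Bool (Option (Fin k)) ℝ)) a α =
      if α = β then P a b else 0 := by
  by_cases h : α = β
  · subst h; simp
  · simp [h]

lemma phi_surj {k : ℕ} (hk : 1 ≤ k) {X : APt k → APt k} (hX : X ∈ aSym k) : ∃ M, phi M = X := by
  haveI : Nontrivial (Option (Fin k)) := ⟨none, some ⟨0, hk⟩, by simp⟩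
  have S := sys_of_sym hk hX
  obtain ⟨E, hE⟩ := S.second
  set K : Bool → Option (Fin k) → Bool → Option (Fin k) → ℝ :=
    fun a α b β => pd (co b β) (cmp X (co a α)) 0 with hK
  set M : Matrix (Ix k) (Ix k) ℝ := Matrix.fromBlocks
    (-(Matrix.of fun a b => K a none b none - if a = b then K false none false none else 0))
    (-(Matrix.of fun a α => X 0 (co a α)))
    (Matrix.of fun β b => E β b)
    (Matrix.of fun β α => K false α false β) with hM
  have m0 : mat (0 : APt k) = 0 := by ext a α; rfl
  have hKs : ∀ a α b β, K a α b β =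
      (if α = β then K a none b none - (if a = b then K false none false none else 0) else 0) +
        (if a = b then K false α false β else 0) := by
    intro a α b β
    by_cases hab : a = b
    · subst hab
      by_cases hαβ : α = β
      · subst hαβ
        have := congrFun (S.H a false α none) 0
        simp only [Pi.add_apply, Pi.sub_apply] at this
        simp [hK, this]; ring
      · simp [hαβ, hK, S.D a false α β hαβ]
    · by_cases hαβ : α = β
      · subst hαβ
        simp [hab, hK, S.A a b α none hab]
      · simp [hab, hαβ, hK, S.Z a α b β hab hαβ]
  have first : ∀ a α b β, pd (co b β) (cmp X (co a α)) =
      fun q => dG M (mat q) (mat (aunit k (co b β))) a α := by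
    intro a α b β
    refine eq_of_pd ((S.sm a α).pd _) (dG_sm _ _ _ _) ?_ ?_
    · apply aco_cases
      · intro c δ q
        rw [hE, pd, fderiv_dG, mat_unit, mat_unit, Matrix.mul_assoc, Matrix.mul_assoc,
          Matrix.add_apply, single_mul', single_mul', mul_single', mul_single']
        simp only [hM, Matrix.toBlocks_fromBlocks₂₁, Matrix.of_apply]
        simp only [ite_and, eq_comm (a := α) (b := δ), eq_comm (a := a) (b := c)]
      · intro σ q
        have : mat (aunit k (pv σ)) = 0 := by
          ext a α; rw [mat_apply, aunit_pv_co]; rfl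
        rw [pd_comm (S.sm a α), S.p, pd_zero, pd, fderiv_dG, this]
        simp
    · rw [m0, mat_unit]
      have := hKs a α b β
      simp only [dG, hM, Matrix.toBlocks_fromBlocks₁₁, Matrix.toBlocks_fromBlocks₂₂, Matrix.mul_zero,
        Matrix.zero_mul, sub_zero, Matrix.neg_apply, Matrix.sub_apply, single_mul', mul_single',
        Matrix.of_apply]
      change K a α b β = _
      rw [this]
      split_ifs <;> ring
  refine ⟨M, sym_ext (phi_mem M) hX ?_⟩
  intro a α
  rw [cmp_phi]
  symm
  refine eq_of_pd (S.sm a α) (Gm_sm _ _ _) ?_ ?_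
  · apply aco_cases
    · intro b β q
      rw [first, pd, fderiv_Gm]
    · intro σ q
      have : mat (aunit k (pv σ)) = 0 := by
        ext a α; rw [mat_apply, aunit_pv_co]; rfl
      rw [S.p, pd, fderiv_Gm, this]
      simp [dG]
  · rw [m0]
    simp [Gm, hM, cmp]

lemma phi_inj {k : ℕ} (M : Matrix (Ix k) (Ix k) ℝ) (h : phi M = 0) : ∃ c : ℝ, M = c • 1 := by
  have hG : ∀ q a α, Gm M (mat q) a α = 0 := by
    intro q a α
    rw [← phi_co, h]; rfl
  have m0 : mat (0 : APt k) = 0 := by ext a α; rfl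
  have hB : M.toBlocks₁₂ = 0 := by
    ext a α
    have := hG 0 a α
    rw [m0] at this
    simpa [Gm] using this
  have hd : ∀ q v a α, dG M (mat q) (mat v) a α = 0 := by
    intro q v a α
    rw [← fderiv_Gm]
    have : (fun q => Gm M (mat q) a α) = fun _ => 0 := by funext q; exact hG q a α
    rw [this]; simp
  have hAD : ∀ a α b β, (if α = β then M.toBlocks₁₁ a b else 0) =
      if a = b then M.toBlocks₂₂ β α else 0 := by
    intro a α b β
    have := hd 0 (aunit k (co b β)) a α
    rw [m0, mat_unit] at this
    simp only [dG, Matrix.mul_zero,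
        Matrix.zero_mul, sub_zero, Matrix.neg_apply, Matrix.sub_apply, single_mul', mul_single'] at this
    linarith
  have hC : M.toBlocks₂₁ = 0 := by
    ext β b
    have := hd (aunit k (co b β)) (aunit k (co b β)) b β
    have h2 := hAD b β b β
    rw [mat_unit] at this
    simp only [dG, Matrix.mul_assoc, Matrix.neg_apply, Matrix.sub_apply, single_mul', mul_single',
      if_true] at this h2
    simp only [Matrix.zero_apply]
    linarith
  have hA : M.toBlocks₁₁ = M.toBlocks₂₂ none none • 1 := by
    ext a b
    have := hAD a none b none
    simp only [if_true] at this
    rw [this, Matrix.smul_apply, Matrix.one_apply]; simp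
  have hD : M.toBlocks₂₂ = M.toBlocks₂₂ none none • 1 := by
    ext β α
    have := hAD false α false β
    have h2 := hAD false none false none
    simp only [if_true] at this h2
    rw [← this, h2, Matrix.smul_apply, Matrix.one_apply]; simp [eq_comm]
  refine ⟨M.toBlocks₂₂ none none, ?_⟩
  rw [← Matrix.fromBlocks_one, Matrix.fromBlocks_smul]
  conv_lhs => rw [← Matrix.fromBlocks_toBlocks M, hA, hB, hC]
  rw [smul_zero, smul_zero, ← hD]

theorem main (k : ℕ) (hk : 1 ≤ k) :
    ∃ Φ : ↥(LieAlgebra.SpecialLinear.sl (Fin (k + 3)) ℝ) →ₗ[ℝ] (APt k → APt k),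
      Function.Injective Φ ∧ Set.range Φ = aSym k ∧
      ∀ A B, Φ ⁅A, B⁆ = aBr k (Φ A) (Φ B) := by
  have hc : Fintype.card (Ix k) = k + 3 := by simp; omega
  let e : Ix k ≃ Fin (k + 3) := Fintype.equivFinOfCardEq hc
  let R : Matrix (Fin (k + 3)) (Fin (k + 3)) ℝ →ₗ[ℝ] Matrix (Ix k) (Ix k) ℝ :=
    { toFun := fun A => A.submatrix e e
      map_add' := fun A B => rfl
      map_smul' := fun c A => rfl }
  have hR : ∀ A, R A = A.submatrix e e := fun A => rfl
  have htr : ∀ A : ↥(LieAlgebra.SpecialLinear.sl (Fin (k + 3)) ℝ), Matrix.trace A.1 = 0 := fun A =>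
    LinearMap.mem_ker.1 A.2
  have hRR : ∀ M : Matrix (Ix k) (Ix k) ℝ, R (M.submatrix e.symm e.symm) = M := by
    intro M
    ext i j
    simp [hR]
  have htrR : ∀ A, Matrix.trace (R A) = Matrix.trace A := by
    intro A
    simp only [hR, Matrix.trace, Matrix.diag, Matrix.submatrix_apply]
    exact Equiv.sum_comp e fun i => A i i
  have hk3 : ((k : ℝ) + 3) ≠ 0 := by positivity
  have htr1 : Matrix.trace (1 : Matrix (Ix k) (Ix k) ℝ) = (k : ℝ) + 3 := by
    rw [Matrix.trace_one, hc]; push_cast; ring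
  have hΦ : ∀ A : ↥(LieAlgebra.SpecialLinear.sl (Fin (k + 3)) ℝ),
      (phiL k).comp (R.comp (Submodule.subtype _)) A = phi (R A.1) := fun A => rfl
  refine ⟨(phiL k).comp (R.comp (Submodule.subtype _)), ?_, ?_, ?_⟩
  · rw [injective_iff_map_eq_zero]
    intro A hA
    obtain ⟨c, h⟩ := phi_inj (R A.1) hA
    have h1 := htrR A.1
    rw [htr, h, Matrix.trace_smul, htr1, smul_eq_mul] at h1
    have hc0 : c = 0 := (mul_eq_zero.1 h1).resolve_right hk3
    rw [hc0, zero_smul] at h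
    apply Subtype.ext
    ext i j
    have h2 := congrFun (congrFun h (e.symm i)) (e.symm j)
    simpa [hR] using h2
  · ext X
    constructor
    · rintro ⟨A, rfl⟩
      exact phi_mem _
    · intro hX
      obtain ⟨M, hM⟩ := phi_surj hk hX
      set N : Matrix (Ix k) (Ix k) ℝ := M - (Matrix.trace M / ((k : ℝ) + 3)) • 1 with hN
      have hN0 : Matrix.trace (N.submatrix e.symm e.symm) = 0 := by
        rw [← htrR, hRR, hN, Matrix.trace_sub, Matrix.trace_smul, htr1, smul_eq_mul]
        field_simp
        ring
      refine ⟨⟨N.submatrix e.symm e.symm, LinearMap.mem_ker.2 hN0⟩, ?_⟩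
      change phi (R (N.submatrix e.symm e.symm)) = X
      rw [hRR, ← phiL_apply, hN, map_sub, map_smul, phiL_apply, phiL_apply, phi_one, smul_zero,
        sub_zero, hM]
  · intro A B
    change phi (R (⁅A, B⁆ : ↥(LieAlgebra.SpecialLinear.sl (Fin (k + 3)) ℝ)).1) =
      aBr k (phi (R A.1)) (phi (R B.1))
    rw [← phi_bracket]
    congr 1
    rw [LieAlgebra.SpecialLinear.sl_bracket, Ring.lie_def, map_sub]
    simp only [hR, Matrix.submatrix_mul_equiv]

end Monge

/-- Let `ℓ ≥ 3`.  The Lie algebra of infinitesimal symmetries of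
the canonical distribution of the Monge system `żⁱ = ẏ⁰ ẏⁱ`, `1 ≤ i ≤ ℓ - 2`, on
`ℝ^{3ℓ-3}` is finite dimensional and isomorphic, as a real Lie algebra, to
`sl(ℓ+1, ℝ)`. -/
theorem statement18 (ℓ : ℕ) (hl : 3 ≤ ℓ) :
    ∃ Φ : ↥(LieAlgebra.SpecialLinear.sl (Fin (ℓ + 1)) ℝ) →ₗ[ℝ] (APt (ℓ - 2) → APt (ℓ - 2)),
      Function.Injective Φ ∧ Set.range Φ = aSym (ℓ - 2) ∧
      ∀ A B, Φ ⁅A, B⁆ = aBr (ℓ - 2) (Φ A) (Φ B) := by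
  obtain ⟨k, rfl⟩ : ∃ k, ℓ = k + 2 := ⟨ℓ - 2, by omega⟩
  exact Monge.main k (by omega)
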